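/- arXiv:2301.03059 — 7 statements merged into one kernel-verified Lean document; each statement's English description precedes it below -/
import Mathlib

section
/- For every element c of the finite field F = GF(3^5), there exist x, y ∈ F such that x^2 + (x·y)^81 − (y^2)^9 = −c. (This is the solvability condition which, by the blocking-set criterion, shows that the point set arising from the Penttila–Williams egg is a blocking set with respect to the relevant family of subspaces.) -/
/-- `F = GF(3^5)`, the finite field with `3^5 = 243` elements. -/
abbrev F : Type := GaloisField 3 5

/-- In a field with 243 elements, every element or its negative is a square. -/
theorem isSquare_or_isSquare_neg_of_natCard_eq {K : Type*} [Field K] (hK : Nat.card K = 243)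
    (c : K) : IsSquare c ∨ IsSquare (-c) := by
  have : Finite K := Nat.finite_of_card_ne_zero (by omega)
  have : Fintype K := Fintype.ofFinite K
  have hc : c ^ 243 = c := by
    simpa [← Nat.card_eq_fintype_card, hK] using FiniteField.pow_card c
  have h : (c - c ^ 122) * (c + c ^ 122) = 0 := by linear_combination -c * hc
  rcases mul_eq_zero.mp h with h | h
  · exact Or.inl ⟨c ^ 61, by linear_combination h⟩
  · exact Or.inr ⟨c ^ 61, by linear_combination -h⟩

/-- For every `c` in `GF(3^5)` there exist `x, y` with
`x^2 + (x*y)^81 - (y^2)^9 = -c`. -/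
theorem solvable_eq_for_all_c (c : F) :
    ∃ x y : F, x ^ 2 + (x * y) ^ 81 - (y ^ 2) ^ 9 = -c := by
  have hF : Nat.card F = 243 := by
    rw [GaloisField.card 3 5 (by norm_num)]
    norm_num
  rcases isSquare_or_isSquare_neg_of_natCard_eq hF c with ⟨s, hs⟩ | ⟨s, hs⟩
  · have : Fintype F := Fintype.ofFinite F
    have hpow : s ^ 243 = s := by
      simpa only [← Nat.card_eq_fintype_card, hF] using FiniteField.pow_card s
    refine ⟨0, s ^ 27, ?_⟩
    have hy : ((s ^ 27) ^ 2) ^ 9 = (s ^ 243) ^ 2 := by simp only [← pow_mul]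
    rw [hy, hpow, hs]
    ring
  · refine ⟨s, 0, ?_⟩
    rw [hs]
    ring
end

section
/- For all a, b, c in the finite field F = GF(3^5), there exist x, y ∈ F such that x^2 + (x·y)^81 − (y^2)^9 + a·x − b^9·y^9 − (b·x + a·y)^81 + c = 0. (Solvability of equation (8) for every triple (a,b,c): every subspace F(a,b,c) of the family F_E meets the point set B_E arising from the Penttila–Williams egg.) -/
theorem F.pow_card (d : F) : d ^ 243 = d := by
  have : Fintype F := Fintype.ofFinite F
  have h : Fintype.card F = 243 := by
    rw [← Nat.card_eq_fintype_card, GaloisField.card 3 5 (by norm_num)]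
    norm_num
  rw [← h, FiniteField.pow_card]

/-- Since `-1` is not a square in `F`, every element is a square or the negative of a square. -/
theorem F.eq_sq_or_eq_neg_sq (d : F) : (∃ u : F, u ^ 2 = d) ∨ ∃ u : F, -u ^ 2 = d := by
  have h : (d ^ 122 - d) * (d ^ 122 + d) = 0 := by
    linear_combination d * F.pow_card d
  rcases mul_eq_zero.mp h with h | h
  · exact .inl ⟨d ^ 61, by linear_combination h⟩
  · exact .inr ⟨d ^ 61, by linear_combination -h⟩

theorem F.add_pow_nine (s t : F) : (s + t) ^ 9 = s ^ 9 + t ^ 9 :=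
  add_pow_char_pow (p := 3) (n := 2) s t

theorem F.add_pow_eighty_one (s t : F) : (s + t) ^ 81 = s ^ 81 + t ^ 81 :=
  add_pow_char_pow (p := 3) (n := 4) s t

/-- Completing squares in characteristic three: the translation `(x, y) = (u + a, v + b)` removes
the linear terms of equation (8). -/
theorem F.translate (a b c u v : F) :
    (u + a) ^ 2 + ((u + a) * (v + b)) ^ 81 - ((v + b) ^ 2) ^ 9 + a * (u + a)
        - b ^ 9 * (v + b) ^ 9 - (b * (u + a) + a * (v + b)) ^ 81 + c
      = u ^ 2 + (u * v) ^ 81 - (v ^ 9) ^ 2 - (a ^ 2 + (a * b) ^ 81 - (b ^ 9) ^ 2 - c) := by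
  have h3 : (3 : F) = 0 := CharP.cast_eq_zero F 3
  have h : ((u + a) * (v + b)) ^ 81 + (a * b) ^ 81
      = (u * v) ^ 81 + (b * (u + a) + a * (v + b)) ^ 81 := by
    rw [← F.add_pow_eighty_one, ← F.add_pow_eighty_one]
    congr 1
    ring
  rw [pow_right_comm (v + b), F.add_pow_nine]
  generalize ((u + a) * (v + b)) ^ 81 = p, (a * b) ^ 81 = q, (u * v) ^ 81 = r,
    (b * (u + a) + a * (v + b)) ^ 81 = s, v ^ 9 = w, b ^ 9 = z at h ⊢
  linear_combination h + (a * u + a ^ 2 - w * z - z ^ 2) * h3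

/-- For all `a, b, c` in `GF(3^5)` the equation (8) of the paper,
`x^2 + (x*y)^81 - (y^2)^9 + a*x - b^9*y^9 - (b*x + a*y)^81 + c = 0`,
has a solution `(x, y)`. -/
theorem eq8_solvable (a b c : F) :
    ∃ x y : F,
      x ^ 2 + (x * y) ^ 81 - (y ^ 2) ^ 9 + a * x - b ^ 9 * y ^ 9
        - (b * x + a * y) ^ 81 + c = 0 := by
  rcases F.eq_sq_or_eq_neg_sq (a ^ 2 + (a * b) ^ 81 - (b ^ 9) ^ 2 - c) with ⟨u, h⟩ | ⟨u, h⟩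
  · refine ⟨u + a, 0 + b, ?_⟩
    rw [F.translate, ← h]
    simp
  · refine ⟨0 + a, u ^ 27 + b, ?_⟩
    rw [F.translate, ← h, ← pow_mul u 27 9, F.pow_card]
    simp
end

section
/- For all a, b, x, y in the finite field F = GF(3^5): if x^2 + (x·y)^81 − (y^2)^9 + a·x − b^9·y^9 − (b·x + a·y)^81 + (a^2 − (b^2)^9 + (a·b)^81) = 0, then x = a and y = b. (Through each point P(a,b) of the set B_E arising from the Penttila–Williams egg there is a member of the family F_E meeting B_E precisely in that point, i.e., B_E is a minimal blocking set with respect to F_E.) -/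
section CharThree

variable {K : Type*} [Field K] [CharP K 3]

/-- If `z` is an 11th root of unity then `1 + z` has norm `-1` over `GF(3)`. -/
lemma one_add_pow_121_of_pow_11_eq_one {z : K} (hz : z ^ 11 = 1) : (1 + z) ^ 121 = -1 := by
  have h3 : (1 + z) ^ 3 = 1 + z ^ 3 := by grind
  have h9 : (1 + z) ^ 9 = 1 + z ^ 9 := by grind
  have h27 : (1 + z) ^ 27 = 1 + z ^ 5 := by grind
  have h81 : (1 + z) ^ 81 = 1 + z ^ 4 := by grind
  have h : (1 + z) ^ 121 = (1 + z) ^ 81 * (1 + z) ^ 27 * (1 + z) ^ 9 * (1 + z) ^ 3 * (1 + z) := by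
    ring
  rw [h, h81, h27, h9, h3]
  grind

/-! Roots of three irreducible quintics over `GF(3)` with constant term `1` have norm `-1`. -/

lemma pow_121_eq_neg_one_of_add_pow_four_sub_pow_three {x : K}
    (hx : x ^ 5 + x ^ 4 - x ^ 3 + 1 = 0) : x ^ 121 = -1 := by
  grind

lemma pow_121_eq_neg_one_of_add_pow_three_sub_sq {x : K}
    (hx : x ^ 5 + x ^ 3 - x ^ 2 + 1 = 0) : x ^ 121 = -1 := by
  grind

lemma pow_121_eq_neg_one_of_add_pow_four_add_sq {x : K}
    (hx : x ^ 5 + x ^ 4 + x ^ 2 + 1 = 0) : x ^ 121 = -1 := by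
  grind

/-- The factorization of `(i ^ 2 - i) ^ 11 + 1` in characteristic three. -/
lemma sub_pow_11_add_one_eq_mul (i : K) :
    (i ^ 2 - i) ^ 11 + 1 = (i + 1) ^ 2 * (i ^ 5 + i ^ 4 - i ^ 3 + 1)
    * (i ^ 5 + i ^ 3 - i ^ 2 + 1)
    * (((i + 1) ^ 2) ^ 5 + ((i + 1) ^ 2) ^ 4 + ((i + 1) ^ 2) ^ 2 + 1) := by
  grind

/-- In a field with `3 ^ 5` elements, no nonzero square `i` makes `i ^ 2 - i` a nonzero
11th power. -/
lemma false_of_sub_pow_22_eq_one (hK : ∀ x : K, x ≠ 0 → x ^ 242 = 1) {i : K}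
    (hi : i ^ 121 = 1) (hz : (i ^ 2 - i) ^ 22 = 1) : False := by
  have hne : (1 : K) ≠ -1 := by
    intro h
    exact one_ne_zero (α := K) (by grind)
  have hi1 : i + 1 ≠ 0 := by
    intro h
    rw [eq_neg_of_add_eq_zero_left h, Odd.neg_one_pow (by decide)] at hi
    exact hne hi.symm
  have hsq : ((i + 1) ^ 2) ^ 121 = 1 := by rw [← pow_mul]; exact hK _ hi1
  have hz' : (i ^ 2 - i) ^ 11 = 1 ∨ (i ^ 2 - i) ^ 11 = -1 :=
    sq_eq_one_iff.1 (by rw [← pow_mul]; exact hz)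
  rcases hz' with h | h
  · have h' := one_add_pow_121_of_pow_11_eq_one h
    have e : 1 + (i ^ 2 - i) = (i + 1) ^ 2 := by grind
    rw [e, hsq] at h'
    exact hne h'
  · have h' := sub_pow_11_add_one_eq_mul i
    rw [h, neg_add_cancel, eq_comm] at h'
    simp only [mul_eq_zero, pow_eq_zero_iff two_ne_zero, hi1, false_or] at h'
    rcases h' with (h' | h') | h'
    · exact hne (hi.symm.trans (pow_121_eq_neg_one_of_add_pow_four_sub_pow_three h'))
    · exact hne (hi.symm.trans (pow_121_eq_neg_one_of_add_pow_three_sub_sq h'))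
    · exact hne (hsq.symm.trans (pow_121_eq_neg_one_of_add_pow_four_add_sq h'))

/-- The form `u ^ 2 + (u * v) ^ 81 - v ^ 18` is anisotropic over a field with `3 ^ 5` elements. -/
lemma eq_zero_of_sq_add_mul_pow_sub_pow_eq_zero (hK : ∀ x : K, x ≠ 0 → x ^ 242 = 1) {u v : K}
    (h : u ^ 2 + (u * v) ^ 81 - v ^ 18 = 0) : u = 0 ∧ v = 0 := by
  by_cases hu : u = 0
  · subst hu
    simpa using h
  by_cases hv : v = 0
  · subst hv
    simp [hu] at h
  exfalso
  have hz : (v ^ 9 / u) ^ 4 - (v ^ 9 / u) ^ 2 = (v ^ 9 * u ^ 7) ^ 11 := by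
    field_simp
    linear_combination -h
  refine false_of_sub_pow_22_eq_one hK (i := (v ^ 9 / u) ^ 2) ?_ ?_
  · rw [← pow_mul]
    exact hK _ (div_ne_zero (pow_ne_zero _ hv) hu)
  · rw [← pow_mul, hz, ← pow_mul]
    exact hK _ (mul_ne_zero (pow_ne_zero _ hv) (pow_ne_zero _ hu))

end CharThree

/-- If `x^2 + (x*y)^81 - (y^2)^9 + a*x - b^9*y^9 - (b*x + a*y)^81
+ (a^2 - (b^2)^9 + (a*b)^81) = 0` then `x = a` and `y = b`:
minimality of the blocking set arising from the Penttila–Williams egg. -/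
theorem minimality (a b x y : F)
    (h : x ^ 2 + (x * y) ^ 81 - (y ^ 2) ^ 9 + a * x - b ^ 9 * y ^ 9
        - (b * x + a * y) ^ 81 + (a ^ 2 - (b ^ 2) ^ 9 + (a * b) ^ 81) = 0) :
    x = a ∧ y = b := by
  have : Fintype F := Fintype.ofFinite F
  have hcard : Fintype.card F = 243 := by
    rw [← Nat.card_eq_fintype_card, GaloisField.card 3 5 (by norm_num)]
    norm_num
  have hK : ∀ z : F, z ≠ 0 → z ^ 242 = 1 := fun z hz => by
    simpa [hcard] using FiniteField.pow_card_sub_one_eq_one z hz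
  have three : (3 : F) = 0 := mod_cast CharP.cast_eq_zero F 3
  have e9 : ((y - b) ^ 2) ^ 9 = (y ^ 2) ^ 9 + b ^ 9 * y ^ 9 + (b ^ 2) ^ 9 := by grind
  have e81 : ((x - a) * (y - b)) ^ 81 = (x * y) ^ 81 - (b * x + a * y) ^ 81 + (a * b) ^ 81 := by
    rw [show (x - a) * (y - b) = x * y - (b * x + a * y) + a * b by ring]
    rw [show 81 = 3 ^ 4 by norm_num, add_pow_char_pow, sub_pow_char_pow]
  have h' : (x - a) ^ 2 + ((x - a) * (y - b)) ^ 81 - (y - b) ^ 18 = 0 := by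
    rw [show (y - b) ^ 18 = ((y - b) ^ 2) ^ 9 by rw [← pow_mul], e9, e81]
    linear_combination h - a * x * three
  obtain ⟨hu, hv⟩ := eq_zero_of_sq_add_mul_pow_sub_pow_eq_zero hK h'
  exact ⟨sub_eq_zero.mp hu, sub_eq_zero.mp hv⟩
end

section
/- For all a, b in the finite field F = GF(3^5): if a^2 − (b^2)^9 + (a·b)^81 = 0, then a = 0 and b = 0. (Anisotropy of the function g_{(a,b)}(1) attached to the Penttila–Williams egg; it expresses that the tangent hyperplane at the egg element E(0,0) meets no other egg element in the affine part with t = 1, and that the line [0,0] is tangent to the constructed unital at the point (0,0).) -/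
/-- The ninth through 243rd powers of a root of `x ^ 6 + x = e`, where `e ^ 11 = 1`, in
characteristic three. -/
theorem pow_243_of_pow_six_add_self {R : Type*} [CommRing R] [CharP R 3] {c e : R}
    (he : e ^ 11 = 1) (hc : c ^ 6 + c = e) :
    c ^ 243 = (e ^ 9 - e ^ 6) * c ^ 4 + (e ^ 7 - e ^ 8 - e ^ 10 + 1) * c ^ 3 - e ^ 3 * c ^ 2 +
      (e ^ 5 - e ^ 4) * c - (e ^ 7 + e ^ 6 + e ^ 5 + e ^ 3 + 1) := by
  have h9 : c ^ 9 = e * c ^ 3 - c ^ 4 := by linear_combination c ^ 3 * hc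
  have h27 : c ^ 27 = e ^ 4 * c ^ 3 - e ^ 3 * c ^ 4 - (e - c) ^ 2 := by
    have : c ^ 27 = (c ^ 9) ^ 3 := by ring
    rw [this, h9]
    grind
  have h81 : c ^ 81 = (e ^ 2 - e ^ 3) * c ^ 3 - e * c ^ 4 - e ^ 9 * c ^ 2 + (1 - e ^ 10) * c
      - 1 - e ^ 6 - e := by
    have : c ^ 81 = (c ^ 27) ^ 3 := by ring
    rw [this, h27]
    grind
  have : c ^ 243 = (c ^ 81) ^ 3 := by ring
  rw [this, h81]
  grind

/-- In a nontrivial commutative ring of characteristic three, no element fixed by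
`x ↦ x ^ 243` satisfies `(x ^ 6 + x) ^ 11 = 1`. -/
theorem pow_six_add_self_pow_eleven_ne_one {R : Type*} [CommRing R] [Nontrivial R] [CharP R 3]
    {c : R} (hF : c ^ 243 = c) : (c ^ 6 + c) ^ 11 ≠ 1 := by
  intro he
  obtain ⟨e, hc⟩ : ∃ e, c ^ 6 + c = e := ⟨_, rfl⟩
  rw [hc] at he
  have hr := pow_243_of_pow_six_add_self he hc
  rw [hF] at hr
  have hu := congrArg (· * ((1 - e - e ^ 2 + e ^ 4 + e ^ 8 + e ^ 9 + e ^ 10) +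
    (-e + e ^ 3 + e ^ 4 - e ^ 7 - e ^ 8 + e ^ 9 - e ^ 10) * c +
    (-1 + e ^ 2 - e ^ 8 - e ^ 9) * c ^ 2 +
    (1 + e ^ 3 + e ^ 4 - e ^ 5 + e ^ 7) * c ^ 3 +
    (-1 + e ^ 3 - e ^ 4 - e ^ 9) * c ^ 4 +
    (-1 + e ^ 2 + e ^ 3 + e ^ 8 - e ^ 10) * c ^ 5)) hr
  have h01 : (1 : R) ≠ 0 := one_ne_zero
  clear hr hF
  grind

/-- Anisotropy of `g_{(a,b)}(1) = a^2 - (b^2)^9 + (a*b)^81` over `GF(3^5)`. -/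
theorem g_anisotropic_at_one (a b : F)
    (h : a ^ 2 - (b ^ 2) ^ 9 + (a * b) ^ 81 = 0) :
    a = 0 ∧ b = 0 := by
  have hq (x : F) : x ^ 243 = x := by
    have := Fintype.ofFinite F
    have hcard : Fintype.card F = 243 := by
      rw [← Nat.card_eq_fintype_card, GaloisField.card 3 5 (by norm_num)]
      norm_num
    simpa only [hcard] using FiniteField.pow_card x
  by_cases hb : b = 0
  · subst hb
    exact ⟨by simpa using h, rfl⟩
  exfalso
  have hone {x : F} (hx : x ≠ 0) : x ^ 242 = 1 :=
    mul_right_cancel₀ hx (by rw [← pow_succ, hq, one_mul])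
  -- The Frobenius image of `h`.
  have hfrob : a ^ 6 - b ^ 54 + a * b = 0 := by
    have hab := hq (a * b)
    have hz : a ^ 2 - b ^ 18 + (a * b) ^ 81 = 0 := by rw [← h]; ring
    have hcube := congrArg (frobenius F 3) hz
    simp only [map_add, map_sub, map_zero, frobenius_def, ← pow_mul] at hcube
    norm_num only at hcube
    rwa [hab] at hcube
  -- Since `5 * 97 = 1` modulo `242`, `b` is a fifth power.
  obtain ⟨d, rfl⟩ : ∃ d, b = d ^ 5 := ⟨b ^ 97, by
    rw [← pow_mul, show 97 * 5 = 242 * 2 + 1 from rfl, pow_succ, pow_mul, hone hb]; simp⟩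
  have hd : d ≠ 0 := fun h0 => hb (by simp [h0])
  obtain ⟨c, rfl⟩ : ∃ c, a = c * d := ⟨a / d, (div_mul_cancel₀ a hd).symm⟩
  have hd270 : d ^ 270 = d ^ 28 := by
    rw [show 270 = 242 + 28 from rfl, pow_add, hone hd, one_mul]
  have hce : c ^ 6 + c = d ^ 22 := by
    refine mul_right_cancel₀ (pow_ne_zero 6 hd) ?_
    linear_combination hfrob + hd270
  refine pow_six_add_self_pow_eleven_ne_one (hq c) ?_
  rw [hce, ← pow_mul, hone hd]
end

section
/- For all a, b, t in the finite field F = GF(3^5) with t ≠ 0: if a^2·t − (b^2)^9·t^9 + (a·b)^81·t^81 = 0, then a = 0 and b = 0. (The tangent space at the element E(0,0) of the dual Penttila–Williams egg in PG(19,3) meets no other egg element: g_{(a,b)}(t) ≠ 0 for all t ≠ 0 whenever (a,b) ≠ (0,0).) -/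
/-- Since the powers of 3 modulo 11 are `1, 3, 9, 5, 4`, the left side is the product of `1 + η ^ r`
over the nonzero squares `r` modulo 11. -/
theorem one_add_pow_of_pow_eleven {K : Type*} [Field K] [CharP K 3] {η : K} (h : η ^ 11 = 1) :
    (1 + η) ^ 121 = -1 := by
  have h3 : (1 + η) ^ 3 = 1 + η ^ 3 := by grind
  have h9 : (1 + η) ^ 9 = 1 + η ^ 9 := by grind
  have h27 : (1 + η) ^ 27 = 1 + η ^ 5 := by grind
  have h81 : (1 + η) ^ 81 = 1 + η ^ 4 := by grind
  calc (1 + η) ^ 121 = (1 + η) * (1 + η) ^ 3 * (1 + η) ^ 9 * (1 + η) ^ 27 * (1 + η) ^ 81 := by ring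
    _ = -1 := by rw [h3, h9, h27, h81]; grind

/-- If `d` lies in the field with 243 elements and `1 - d ^ 2` is an eleventh root of unity,
then `d - 1` is a nonsquare. -/
theorem sub_one_pow_of_one_sub_sq_pow_eleven {K : Type*} [Field K] [CharP K 3] {d : K}
    (h : (1 - d ^ 2) ^ 11 = 1) (hd : d ^ 243 = d) : (d - 1) ^ 121 = -1 := by
  have hfac : d * (((d ^ 2) ^ 5 + (d ^ 2) ^ 4 + (d ^ 2) ^ 2 + 1) *
      ((d ^ 5 + d ^ 4 - d ^ 3 + d ^ 2 + d + 1) * (d ^ 5 - d ^ 4 - d ^ 3 - d ^ 2 + d - 1))) = 0 := by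
    apply pow_eq_zero_iff two_ne_zero |>.mp
    grind
  rcases mul_eq_zero.mp hfac with rfl | hfac
  · norm_num
  rcases mul_eq_zero.mp hfac with hX | hfac
  · have hneg : (d ^ 2) ^ 121 = -1 := by
      generalize d ^ 2 = x at hX
      grind
    have hzero : d = 0 := by
      have : d ^ 243 = -d := by linear_combination d * hneg
      grind
    simp [hzero] at hX
  · rcases mul_eq_zero.mp hfac with hd | hd <;> clear * - hd <;> grind

/-- In the field with 243 elements, the ratio of `(1 - p) ^ 11` to `p ^ 22` is never `±1` for a
nonzero square `p`. -/
theorem one_sub_pow_eleven_ne {K : Type*} [Field K] [CharP K 3]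
    (hK : ∀ x : K, x ^ 243 = x) {p ε : K} (hp : p ^ 121 = 1) (hε : ε ^ 2 = 1) :
    (1 - p) ^ 11 ≠ ε * p ^ 22 := by
  intro h
  have h3 : (3 : K) = 0 := CharP.cast_eq_zero K 3
  have hne : (1 : K) ≠ -1 := fun h => one_ne_zero (α := K) (by grind)
  have hp0 : p ≠ 0 := by rintro rfl; simp at hp
  obtain ⟨η, hη⟩ : ∃ η, η * p ^ 2 = ε * (1 - p) :=
    ⟨ε * (1 - p) / p ^ 2, div_mul_cancel₀ _ (pow_ne_zero 2 hp0)⟩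
  have hη11 : η ^ 11 = 1 := by
    apply mul_right_cancel₀ (pow_ne_zero 22 hp0)
    calc η ^ 11 * p ^ 22 = (η * p ^ 2) ^ 11 := by ring
      _ = (ε ^ 2) ^ 5 * ε * (1 - p) ^ 11 := by rw [hη]; ring
      _ = (ε ^ 2) ^ 6 * p ^ 22 := by rw [h]; ring
      _ = 1 * p ^ 22 := by rw [hε, one_pow]
  rcases sq_eq_sq_iff_eq_or_eq_neg.mp (hε.trans (one_pow 2).symm) with rfl | rfl
  · have hd : (η * p - 1) ^ 2 = 1 + η := by linear_combination η * hη - η * p * h3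
    have hneg : ((η * p - 1) ^ 2) ^ 121 = -1 := by rw [hd, one_add_pow_of_pow_eleven hη11]
    have hzero : η * p - 1 = 0 := by
      have := hK (η * p - 1)
      have : (η * p - 1) = -(η * p - 1) := by linear_combination (η * p - 1) * hneg - this
      grind
    simp [hzero] at hneg
  · have hd : 1 - (η * p + 1) ^ 2 = η := by linear_combination -η * hη - η * p * h3
    have hneg := sub_one_pow_of_one_sub_sq_pow_eleven (hd.symm ▸ hη11) (hK _)
    rw [add_sub_cancel_right, mul_pow, hp, show 121 = 11 * 11 from rfl, pow_mul, hη11] at hneg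
    exact hne (by simpa using hneg)

/-- For `t ≠ 0`, `g_{(a,b)}(t) = a^2*t - (b^2)^9*t^9 + (a*b)^81*t^81 = 0`
forces `a = 0` and `b = 0`. -/
theorem g_anisotropic (a b t : F) (ht : t ≠ 0)
    (h : a ^ 2 * t - (b ^ 2) ^ 9 * t ^ 9 + (a * b) ^ 81 * t ^ 81 = 0) :
    a = 0 ∧ b = 0 := by
  have hK (x : F) : x ^ 243 = x := by
    have : Fintype F := Fintype.ofFinite F
    have hcard : Fintype.card F = 243 := by
      rw [← Nat.card_eq_fintype_card, GaloisField.card 3 5 (by norm_num)]; norm_num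
    simpa [hcard] using FiniteField.pow_card x
  have hunit {x : F} (hx : x ≠ 0) : x ^ 242 = 1 :=
    mul_right_cancel₀ hx (by linear_combination hK x)
  by_cases hb : b = 0
  · subst hb
    simpa [ht] using h
  by_cases ha : a = 0
  · subst ha
    simpa [ht] using h
  exfalso
  have hc : (b ^ 2 * t) ^ 9 ≠ 0 := by positivity
  refine one_sub_pow_eleven_ne hK (p := a ^ 2 * t / (b ^ 2 * t) ^ 9)
    (ε := (a ^ 7 * b ^ 9 * t ^ 8) ^ 121) ?_ ?_ ?_
  · rw [div_pow, div_eq_one_iff_eq (pow_ne_zero _ hc)]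
    calc (a ^ 2 * t) ^ 121 = a ^ 242 * t ^ 121 := by ring
      _ = (b ^ 242) ^ 9 * (t ^ 242) ^ 4 * t ^ 121 := by
        simp only [hunit ha, hunit hb, hunit ht, one_pow, one_mul]
      _ = _ := by ring
  · rw [← pow_mul]
    exact hunit (by simp [ha, hb, ht])
  · have hq : 1 - a ^ 2 * t / (b ^ 2 * t) ^ 9 = (a * b * t) ^ 81 / (b ^ 2 * t) ^ 9 := by
      rw [eq_div_iff hc, sub_mul, div_mul_cancel₀ _ hc]
      linear_combination -h
    rw [hq]
    field_simp
end

section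
/- For all pairs (a,b) ≠ (a',b') of elements of F × F, where F = GF(3^5), the map from F × F to itself sending (x,y) to ((b − b')·x + (a − a')·y, −(a − a')·x + b^9·y^9 − b'^9·y^9) is bijective. (Equivalently, the differences τ_{(a,b)} − τ_{(a',b')} of the maps τ_{(a,b)}: (x,y) ↦ (b·x + a·y, −a·x + b^9·y^9) are non-singular, so that the subspaces S(a,b) together with S_∞ form a 9-spread S of PG(19,3), whose associated translation plane Π(S) is the Dickson commutative semifield plane of order 3^10.) -/
theorem not_isSquare_neg_one : ¬ IsSquare (-1 : F) := by
  have := Fintype.ofFinite F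
  rw [FiniteField.isSquare_neg_one_iff, not_not, ← Nat.card_eq_fintype_card,
    GaloisField.card 3 5 (by norm_num)]
  norm_num

theorem sub_pow_nine (u v : F) : (u - v) ^ 9 = u ^ 9 - v ^ 9 :=
  sub_pow_char_pow (p := 3) (n := 2) u v

/-- The kernel of `τ_{(A,B)}` is trivial for `(A,B) ≠ (0,0)` when `-1` is not a square. -/
theorem tau_eq_zero {K : Type*} [Field K] (hneg : ¬ IsSquare (-1 : K))
    {A B x y : K} (hAB : A ≠ 0 ∨ B ≠ 0)
    (h₁ : B * x + A * y = 0) (h₂ : -A * x + B ^ 9 * y ^ 9 = 0) : x = 0 ∧ y = 0 := by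
  by_cases hB : B = 0
  · simp_all
  have hy : y = 0 := by
    by_contra hy
    have hsum : A ^ 2 + (B ^ 5 * y ^ 4) ^ 2 = 0 := by
      refine (mul_eq_zero.mp ?_).resolve_left hy
      linear_combination A * h₁ + B * h₂
    have hc : B ^ 5 * y ^ 4 ≠ 0 := by simp [hB, hy]
    refine hneg ⟨A / (B ^ 5 * y ^ 4), ?_⟩
    rw [div_mul_div_comm, eq_div_iff (mul_ne_zero hc hc)]
    linear_combination -hsum
  simp_all

/-- For `(a,b) ≠ (a',b')` the difference `τ_{(a,b)} - τ_{(a',b')}` of the maps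
`τ_{(a,b)}(x,y) = (b*x + a*y, -a*x + b^9*y^9)` is a bijection of `F × F`;
hence the subspaces `S(a,b)` together with `S_∞` form a 9-spread of
`PG(19,3)` whose translation plane is the Dickson commutative semifield plane
of order `3^10`. -/
theorem tau_difference_bijective (a b a' b' : F)
    (hne : (a, b) ≠ (a', b')) :
    Function.Bijective (fun p : F × F =>
      ((b - b') * p.1 + (a - a') * p.2,
        -(a - a') * p.1 + b ^ 9 * p.2 ^ 9 - b' ^ 9 * p.2 ^ 9)) := by
  refine Finite.injective_iff_bijective.mp fun p q hpq => ?_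
  obtain ⟨h₁, h₂⟩ := Prod.mk.inj hpq
  have hAB : a - a' ≠ 0 ∨ b - b' ≠ 0 := by
    by_contra! h
    exact hne (Prod.ext (sub_eq_zero.mp h.1) (sub_eq_zero.mp h.2))
  have hzero := tau_eq_zero not_isSquare_neg_one (x := p.1 - q.1) (y := p.2 - q.2)
    hAB (by linear_combination h₁)
    (by rw [sub_pow_nine, sub_pow_nine]; linear_combination h₂)
  exact Prod.ext (sub_eq_zero.mp hzero.1) (sub_eq_zero.mp hzero.2)
end

section
/- For all a, b, c in the finite field F = GF(3^5): if c = 0 and a^2 − (b^2)^9 + (a·b)^81 + c^81 = 0, then a = 0 and b = 0. (The affine part of the constructed unital U = { (a^2 − (b^2)^9 + (a·b)^81 + c^81, c, −a, −b) : a,b,c ∈ F } meets the line [0,0] of the Dickson commutative semifield plane of order 3^10 only in the point (0,0,0,0), i.e., [0,0] is the tangent line of U at (0,0).) -/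
/-- The polynomials `(1 - t ^ 2) ^ 33 - t ^ 11` and `t ^ 77 * (1 - t ^ 2) ^ 11 - 1` are coprime
over a ring of characteristic three; the proof is an explicit Bézout identity. -/
lemma false_of_one_sub_sq_pow_eq {R : Type*} [CommRing R] [Nontrivial R] [CharP R 3] (t : R)
    (h₁ : (1 - t ^ 2) ^ 33 = t ^ 11) (h₂ : t ^ 77 * (1 - t ^ 2) ^ 11 = 1) : False := by
  have : Fact (Nat.Prime 3) := ⟨Nat.prime_three⟩
  have three : (3 : R) = 0 := by exact_mod_cast CharP.cast_eq_zero R 3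
  have frob₉ : (1 - t ^ 2) ^ 9 = 1 - t ^ 18 := by
    rw [show (9 : ℕ) = 3 ^ 2 by norm_num, sub_pow_char_pow, one_pow, ← pow_mul]
    norm_num
  have frob₂₇ : (1 - t ^ 2) ^ 27 = 1 - t ^ 54 := by
    rw [show (27 : ℕ) = 3 ^ 3 by norm_num, sub_pow_char_pow, one_pow, ← pow_mul]
    norm_num
  have frob₃ : (1 - t ^ 2) ^ 3 = 1 - t ^ 6 := by
    rw [sub_pow_char, one_pow, ← pow_mul]
  have e₁ : 1 + t ^ 6 + t ^ 12 - t ^ 54 - t ^ 60 - t ^ 66 - t ^ 11 = 0 := by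
    rw [show (33 : ℕ) = 27 + 3 * 2 by norm_num, pow_add, pow_mul, frob₂₇, frob₃] at h₁
    linear_combination h₁ + (t ^ 6 - t ^ 60) * three
  have e₂ : t ^ 77 + t ^ 79 + t ^ 81 - t ^ 95 - t ^ 97 - t ^ 99 - 1 = 0 := by
    rw [show (11 : ℕ) = 9 + 2 by norm_num, pow_add, frob₉] at h₂
    linear_combination h₂ + (t ^ 79 - t ^ 97) * three
  have : (1 : R) = 0 := by
    linear_combination
      (
      1 + t + t ^ 3 + t ^ 5 - t ^ 6 + t ^ 8 - t ^ 10 + t ^ 11 + t ^ 12 + t ^ 14 + t ^ 16 + t ^ 17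
      + t ^ 18 - t ^ 19 - t ^ 23 + t ^ 24 + t ^ 25 - t ^ 28 + t ^ 29 - t ^ 30 - t ^ 31 - t ^ 32
      + t ^ 33 - t ^ 34 + t ^ 35 + t ^ 36 - t ^ 37 - t ^ 38 - t ^ 39 - t ^ 40 + t ^ 43 - t ^ 45
      - t ^ 46 + t ^ 49 + t ^ 50 + t ^ 51 - t ^ 52 + t ^ 53 + t ^ 54 - t ^ 56 - t ^ 58 - t ^ 59
      - t ^ 60 + t ^ 66 + t ^ 72 - t ^ 73 - t ^ 74 - t ^ 77 + t ^ 79 - t ^ 84 + t ^ 87 - t ^ 89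
      + t ^ 91 + t ^ 92 - t ^ 93 + t ^ 95 - t ^ 96 - t ^ 97) * e₁ + (
      t + t ^ 3 + t ^ 5 + t ^ 7 + t ^ 8 + t ^ 9 - t ^ 10 + t ^ 11 + t ^ 13 + t ^ 14 + t ^ 15
      - t ^ 16 + t ^ 17 + t ^ 18 + t ^ 19 - t ^ 20 + t ^ 21 - t ^ 22 - t ^ 25 + t ^ 26 - t ^ 27
      - t ^ 28 - t ^ 30 - t ^ 31 - t ^ 32 + t ^ 33 - t ^ 34 - t ^ 37 + t ^ 38 + t ^ 39 - t ^ 40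
      + t ^ 42 - t ^ 46 - t ^ 48 - t ^ 49 + t ^ 50 + t ^ 53 - t ^ 54 + t ^ 55 + t ^ 56 - t ^ 59
      - t ^ 60 - t ^ 61 + t ^ 62 + t ^ 63 + t ^ 64) * e₂ - (
      t ^ 17 - t ^ 19 + t ^ 20 + t ^ 24 + t ^ 30 - t ^ 38 - t ^ 40 + t ^ 41 - t ^ 44 - t ^ 46
      + t ^ 48 + t ^ 49 - t ^ 52 - t ^ 58 - t ^ 62 - t ^ 64 - t ^ 65 - t ^ 68 - t ^ 71 - t ^ 74
      - t ^ 77 + t ^ 82 - t ^ 83 + t ^ 84 + t ^ 85 + t ^ 86 + 2 * t ^ 88 - t ^ 89 + t ^ 91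
      + 2 * t ^ 92 + 2 * t ^ 94 + t ^ 98 + t ^ 100 - t ^ 101 - 2 * t ^ 102 - t ^ 103 - t ^ 104
      - t ^ 106 - 2 * t ^ 108 - 2 * t ^ 109 - t ^ 110 - t ^ 111 - t ^ 113 - t ^ 114 - t ^ 116
      + t ^ 119 + t ^ 122 + t ^ 124 + t ^ 127 + t ^ 129 + t ^ 131 + t ^ 134 - t ^ 138
      + 2 * t ^ 143 + t ^ 144 - t ^ 152 + t ^ 156 - t ^ 161) * three
  exact one_ne_zero this

/-- The affine part of the constructed unital meets the line `[0,0]` only in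
the point `(0,0,0,0)`: if `c = 0` and
`a^2 - (b^2)^9 + (a*b)^81 + c^81 = 0` then `a = 0` and `b = 0`. -/
theorem tangent_line_at_origin (a b c : F) (hc : c = 0)
    (h : a ^ 2 - (b ^ 2) ^ 9 + (a * b) ^ 81 + c ^ 81 = 0) :
    a = 0 ∧ b = 0 := by
  subst hc
  by_cases hb : b = 0
  · subst hb
    simpa using h
  have : Fintype F := Fintype.ofFinite F
  have card : Fintype.card F = 243 := by
    rw [← Nat.card_eq_fintype_card, GaloisField.card 3 5 (by norm_num)]
    norm_num
  have pow_card (x : F) (hx : x ≠ 0) : x ^ 242 = 1 := by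
    simpa [card] using FiniteField.pow_card_sub_one_eq_one x hx
  have ha : a ≠ 0 := by
    rintro rfl
    exact hb (by simpa using h)
  have hb' := pow_card b hb
  obtain ⟨t, rfl⟩ : ∃ t, a = t * b ^ 9 := ⟨a / b ^ 9, by field_simp⟩
  have ht := pow_card t (left_ne_zero_of_mul ha)
  have key : 1 - t ^ 2 = b ^ 66 * t ^ 81 := by
    have hbb : b ^ 810 = b ^ 18 * b ^ 66 := by
      rw [show (810 : ℕ) = 242 * 3 + 84 by norm_num, pow_add, pow_mul, hb', one_pow, one_mul,
        ← pow_add]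
    refine mul_left_cancel₀ (pow_ne_zero 18 hb) ?_
    linear_combination -h + t ^ 81 * hbb
  have h₁₁ : (1 - t ^ 2) ^ 11 = t ^ 165 := by
    rw [key, mul_pow, ← pow_mul, ← pow_mul, show 66 * 11 = 242 * 3 by norm_num, pow_mul b, hb',
      one_pow, one_mul, show 81 * 11 = 242 * 3 + 165 by norm_num, pow_add, pow_mul t, ht,
      one_pow, one_mul]
  refine (false_of_one_sub_sq_pow_eq t ?_ ?_).elim
  · rw [show (33 : ℕ) = 11 * 3 by norm_num, pow_mul, h₁₁, ← pow_mul,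
      show 165 * 3 = 242 * 2 + 11 by norm_num, pow_add, pow_mul, ht, one_pow, one_mul]
  · rw [h₁₁, ← pow_add, ht]
end
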